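/- arXiv:1802.05109 — 4 statements merged into one kernel-verified Lean document; each statement's English description precedes it below -/
import Mathlib

section
/- Let A be a commutative ring, B = A[Y_1,...,Y_n]/I with I a finitely generated ideal, and f = (f_1,...,f_r), r ≤ n, a system of polynomials from I. If the ideal ((f):I)·Δ_f·B equals B (where Δ_f is the ideal generated by the r×r minors of the Jacobian matrix (∂f_i/∂Y_j)), then B is a smooth A-algebra. -/
open MvPolynomial

section helpers

open TensorProduct

lemma smul_cotangent_zero {P : Type*} [CommRing P] (J : Ideal P) {p : P} (hp : p ∈ J)
    (m : J.Cotangent) : p • m = 0 := by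
  obtain ⟨y, rfl⟩ := J.toCotangent_surjective m
  rw [← map_smul, Ideal.toCotangent_eq_zero, pow_two]
  exact Ideal.mul_mem_mul hp y.2

lemma formallySmooth_of_derivation {A P : Type*} [CommRing A] [CommRing P] [Algebra A P]
    [Algebra.FormallySmooth A P] (I : Ideal P)
    (D : Derivation A P (RingHom.ker (algebraMap P (P ⧸ I))).Cotangent)
    (hD : ∀ x : RingHom.ker (algebraMap P (P ⧸ I)), D x.1 = Ideal.toCotangent _ x) :
    Algebra.FormallySmooth A (P ⧸ I) := by
  rw [Algebra.FormallySmooth.iff_split_injection (P := P) Ideal.Quotient.mk_surjective]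
  have hker : I ≤ LinearMap.ker (LinearMap.toSpanSingleton P _ D.liftKaehlerDifferential) := by
    intro p hp
    rw [LinearMap.mem_ker, LinearMap.toSpanSingleton_apply]
    refine LinearMap.ext fun m => ?_
    exact smul_cotangent_zero _ (by simpa [Ideal.Quotient.eq_zero_iff_mem] using hp) _
  refine ⟨TensorProduct.lift (Submodule.liftQ I _ hker), ?_⟩
  ext1 m
  obtain ⟨y, rfl⟩ := Ideal.toCotangent_surjective _ m
  have h1 : (1 : P ⧸ I) = Submodule.Quotient.mk 1 := rfl
  rw [LinearMap.comp_apply, KaehlerDifferential.kerCotangentToTensor_toCotangent,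
    TensorProduct.lift.tmul, h1, Submodule.liftQ_apply, LinearMap.toSpanSingleton_apply, one_smul,
    Derivation.liftKaehlerDifferential_comp_D, hD]
  rfl

/-- The ideal of elements `p` such that multiplication by `p` on `J/J²` factors through a
derivation. -/
def splitIdeal (A : Type*) {P : Type*} [CommRing A] [CommRing P] [Algebra A P] (J : Ideal P) :
    Ideal P where
  carrier := {p | ∃ D : Derivation A P J.Cotangent, ∀ x : J, D x.1 = p • J.toCotangent x}
  add_mem' := by
    rintro a b ⟨D, hD⟩ ⟨E, hE⟩
    exact ⟨D + E, fun x => by rw [Derivation.add_apply, hD, hE, add_smul]⟩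
  zero_mem' := ⟨0, fun x => by simp⟩
  smul_mem' := by
    rintro c a ⟨D, hD⟩
    exact ⟨c • D, fun x => by rw [Derivation.smul_apply, hD, smul_smul, smul_eq_mul]⟩

lemma le_splitIdeal (A : Type*) {P : Type*} [CommRing A] [CommRing P] [Algebra A P]
    (J : Ideal P) : J ≤ splitIdeal A J :=
  fun _ hp => ⟨0, fun x => by rw [smul_cotangent_zero J hp]; rfl⟩

lemma mul_mem_splitIdeal {A : Type*} [CommRing A] {n r : ℕ}
    (J : Ideal (MvPolynomial (Fin n) A))
    (f : Fin r → MvPolynomial (Fin n) A) (hf : ∀ i, f i ∈ J)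
    (g : MvPolynomial (Fin n) A) (hg : ∀ x ∈ J, g * x ∈ Ideal.span (Set.range f))
    (c : Fin r ↪ Fin n) :
    g * (Matrix.of fun i k => pderiv (c k) (f i)).det ∈ splitIdeal A J := by
  classical
  set M : Matrix (Fin r) (Fin r) (MvPolynomial (Fin n) A) :=
    Matrix.of fun i k => pderiv (c k) (f i) with hM
  let F : Fin r → J.Cotangent := fun i => J.toCotangent ⟨f i, hf i⟩
  let D : Derivation A (MvPolynomial (Fin n) A) J.Cotangent :=
    ∑ k, ((∑ l, M.adjugate k l • (LinearMap.toSpanSingleton _ _ (F l)))).compDer (pderiv (c k))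
  have hDa : ∀ p, D p = ∑ k, ∑ l, (pderiv (c k) p * M.adjugate k l) • F l := by
    intro p
    have hs := congrFun (map_sum (Derivation.coeFnAddMonoidHom (R := A)
      (A := MvPolynomial (Fin n) A) (M := J.Cotangent)) (fun k =>
      (∑ l, M.adjugate k l • (LinearMap.toSpanSingleton _ _ (F l))).compDer (pderiv (c k)))
      Finset.univ) p
    rw [Finset.sum_apply] at hs
    refine hs.trans (Finset.sum_congr rfl fun k _ => ?_)
    change (∑ l, M.adjugate k l • (LinearMap.toSpanSingleton _ _ (F l))) (pderiv (c k) p) = _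
    rw [LinearMap.sum_apply]
    refine Finset.sum_congr rfl fun l _ => ?_
    rw [LinearMap.smul_apply, LinearMap.toSpanSingleton_apply, smul_smul, mul_comm]
  have hDf : ∀ i, D (f i) = M.det • F i := by
    intro i
    rw [hDa, Finset.sum_comm]
    have : ∀ l, ∑ k, (pderiv (c k) (f i) * M.adjugate k l) • F l
        = (if i = l then M.det else 0) • F l := by
      intro l
      rw [← Finset.sum_smul]
      congr 1
      have := congrFun (congrFun M.mul_adjugate i) l
      rw [Matrix.mul_apply] at this
      simpa [hM, Matrix.one_apply] using this
    simp [this, ite_smul]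
  have hDs : ∀ x : J, x.1 ∈ Ideal.span (Set.range f) → D x.1 = M.det • J.toCotangent x := by
    rintro ⟨x, hx⟩ hxs
    obtain ⟨a, rfl⟩ := (Ideal.mem_span_range_iff_exists_fun).1 hxs
    have e : (⟨∑ i, a i * f i, hx⟩ : J) = ∑ i, a i • (⟨f i, hf i⟩ : J) := by
      ext1; simp
    rw [e, map_sum, Finset.smul_sum, ← e]
    change D (∑ i, a i * f i) = _
    rw [map_sum]
    refine Finset.sum_congr rfl fun i _ => ?_
    rw [Derivation.leibniz, hDf, smul_cotangent_zero J (hf i), add_zero, map_smul, smul_comm]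
  refine ⟨g • D, fun x => ?_⟩
  have h1 := hDs (g • x) (hg x x.2)
  have h2 : D (g • x : J).1 = g • D x.1 := by
    change D (g * x.1) = _
    rw [Derivation.leibniz, smul_cotangent_zero J x.2, add_zero]
  rw [Derivation.smul_apply, ← h2, h1, map_smul, smul_smul, mul_comm]

end helpers

/-- If `B = A[Y]/I` and `f = (f_1,...,f_r) ⊆ I`, `r ≤ n`, are such that
`((f):I)·Δ_f·B = B`, where `Δ_f` is the ideal of `r × r` minors of the Jacobian
matrix of `f`, then `B` is a smooth `A`-algebra. -/
theorem stmt_4 (A : Type*) [CommRing A] [IsNoetherianRing A] (n r : ℕ) (hrn : r ≤ n)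
    (I : Ideal (MvPolynomial (Fin n) A)) (hIfg : I.FG)
    (f : Fin r → MvPolynomial (Fin n) A) (hfI : ∀ i, f i ∈ I)
    (Δ : Ideal (MvPolynomial (Fin n) A))
    (hΔ : Δ = Ideal.span { M | ∃ c : Fin r ↪ Fin n,
      M = (Matrix.of fun i k => pderiv (c k) (f i)).det })
    (h : Ideal.map (Ideal.Quotient.mk I)
      ((Submodule.colon (Ideal.span (Set.range f)) I) * Δ) = ⊤) :
    Algebra.Smooth A (MvPolynomial (Fin n) A ⧸ I) := by
  have hker : RingHom.ker (algebraMap (MvPolynomial (Fin n) A) (MvPolynomial (Fin n) A ⧸ I)) = I :=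
    Ideal.mk_ker
  have : Algebra.FormallySmooth A (MvPolynomial (Fin n) A ⧸ I) := by
    set J := RingHom.ker (algebraMap (MvPolynomial (Fin n) A) (MvPolynomial (Fin n) A ⧸ I)) with hJ
    have hle : (Submodule.colon (Ideal.span (Set.range f)) (I : Set _)) * Δ ≤ splitIdeal A J := by
      rw [Ideal.mul_le]
      intro g hg d hd
      have : Δ ≤ Submodule.colon (splitIdeal A J) {g} := by
        rw [hΔ, Ideal.span_le]
        rintro _ ⟨c, rfl⟩
        rw [SetLike.mem_coe, Submodule.mem_colon_singleton, smul_eq_mul, mul_comm]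
        refine mul_mem_splitIdeal J f (fun i => hker.symm ▸ hfI i) g (fun x hx => ?_) c
        exact Submodule.mem_colon.1 hg x (by rw [hker] at hx; exact hx)
      have := this hd
      rwa [Submodule.mem_colon_singleton, smul_eq_mul, mul_comm] at this
    have h1 : (1 : MvPolynomial (Fin n) A) ∈ splitIdeal A J := by
      have h2 := (Ideal.eq_top_iff_one _).1 h
      rw [← map_one (Ideal.Quotient.mk I),
        Ideal.mem_map_iff_of_surjective _ Ideal.Quotient.mk_surjective] at h2
      obtain ⟨y, hy, hy1⟩ := h2
      have h3 : 1 - y ∈ J := by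
        rw [hker]; exact Ideal.Quotient.eq.1 hy1.symm
      have := (splitIdeal A J).add_mem (le_splitIdeal A J h3) (hle hy)
      rwa [sub_add_cancel] at this
    obtain ⟨D, hD⟩ := h1
    exact formallySmooth_of_derivation I D fun x => by rw [hD, one_smul]
  exact ⟨this, Algebra.FinitePresentation.quotient hIfg⟩
end

section
/- Let A be a ring and B = A[Y]/I a finitely presented A-algebra. Define H_{B/A} as the radical of the sum over all systems f = (f_1,...,f_r) of polynomials from I with r ≤ n of the ideals ((f):I)·Δ_f·B. Then for any element b ∈ H_{B/A}, the localization B_b is a smooth A-algebra; in particular, if H_{B/A} = B then B is smooth over A. -/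
open MvPolynomial

universe u

lemma taylor_sq_zero {A C : Type*} [CommRing A] [CommRing C] [Algebra A C] {n : ℕ}
    (y δ : Fin n → C) (h : ∀ i j, δ i * δ j = 0) (p : MvPolynomial (Fin n) A) :
    aeval (fun i => y i + δ i) p = aeval y p + ∑ i, δ i * aeval y (pderiv i p) := by
  induction p using MvPolynomial.induction_on with
  | C a => simp
  | add p q hp hq =>
    simp only [map_add, hp, hq, mul_add, Finset.sum_add_distrib]; ring
  | mul_X p j hp =>
    have h1 : (∑ i, δ i * aeval y (pderiv i p)) * δ j = 0 := by
      rw [Finset.sum_mul]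
      refine Finset.sum_eq_zero fun i _ => ?_
      rw [mul_right_comm, h, zero_mul]
    have h2 : ∑ i, δ i * aeval y (pderiv i (p * X j)) =
        (∑ i, δ i * aeval y (pderiv i p)) * y j + δ j * aeval y p := by
      have : ∀ i, δ i * aeval y (pderiv i (p * X j)) =
          δ i * aeval y (pderiv i p) * y j + if i = j then δ j * aeval y p else 0 := by
        intro i
        rw [pderiv_mul, pderiv_X]
        by_cases hij : i = j
        · subst hij; simp; ring
        · simp [hij, Ne.symm hij]; ring
      simp only [this, Finset.sum_add_distrib, Finset.sum_mul]
      simp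
    rw [h2]
    simp only [map_mul, aeval_X, hp]
    linear_combination h1

lemma formallySmooth_elkik {A : Type u} [CommRing A] {n : ℕ}
    (I : Ideal (MvPolynomial (Fin n) A)) {r : ℕ} (f : Fin r → MvPolynomial (Fin n) A)
    (hf : ∀ i, f i ∈ I) (h : MvPolynomial (Fin n) A)
    (hh : h ∈ Submodule.colon (Ideal.span (Set.range f)) (I : Set (MvPolynomial (Fin n) A)))
    (c : Fin r ↪ Fin n) (L : Type u) [CommRing L] [Algebra (MvPolynomial (Fin n) A ⧸ I) L]
    [Algebra A L] [IsScalarTower A (MvPolynomial (Fin n) A ⧸ I) L]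
    [IsLocalization.Away (Ideal.Quotient.mk I
      (h * (Matrix.of fun i k => pderiv (c k) (f i)).det)) L] :
    Algebra.FormallySmooth A L := by
  classical
  set d := (Matrix.of fun i k => pderiv (c k) (f i)).det with hd
  refine Algebra.FormallySmooth.of_comp_surjective fun C _ _ J hJ g => ?_
  have hJ0 : ∀ x ∈ J, ∀ y ∈ J, x * y = 0 := fun x hx y hy => by
    have : x * y ∈ J ^ 2 := by rw [pow_two]; exact Ideal.mul_mem_mul hx hy
    rwa [hJ] at this
  let ι : MvPolynomial (Fin n) A →ₐ[A] L :=
    (IsScalarTower.toAlgHom A (MvPolynomial (Fin n) A ⧸ I) L).comp (Ideal.Quotient.mkₐ A I)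
  have hι : ∀ p, ι p = algebraMap (MvPolynomial (Fin n) A ⧸ I) L (Ideal.Quotient.mk I p) :=
    fun p => rfl
  have hιI : ∀ p ∈ I, ι p = 0 := fun p hp => by
    rw [hι, Ideal.Quotient.eq_zero_iff_mem.2 hp, map_zero]
  choose y hy using fun i => Ideal.Quotient.mk_surjective (I := J) (g (ι (X i)))
  have lift_mk : ∀ z : Fin n → C, (∀ i, Ideal.Quotient.mk J (z i) = g (ι (X i))) →
      ∀ p, Ideal.Quotient.mk J (aeval z p) = g (ι p) := by
    intro z hz p
    have : (Ideal.Quotient.mkₐ A J).comp (aeval z) = g.comp ι := by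
      ext i; simpa using hz i
    exact DFunLike.congr_fun this p
  have hunit : ∀ z : Fin n → C, (∀ i, Ideal.Quotient.mk J (z i) = g (ι (X i))) →
      IsUnit (aeval z (h * d)) := by
    intro z hz
    rw [← IsNilpotent.isUnit_quotient_mk_iff (I := J) ⟨2, hJ⟩, lift_mk z hz, hι]
    exact (IsLocalization.Away.algebraMap_isUnit _).map g
  let M : Matrix (Fin r) (Fin r) C := Matrix.of fun i k => aeval y (pderiv (c k) (f i))
  have hM : IsUnit M.det := by
    have h1 := hunit y hy
    rw [map_mul] at h1
    have h2 : aeval y d = M.det := by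
      rw [hd, AlgHom.map_det]; rfl
    rw [← h2]; exact isUnit_of_mul_isUnit_right h1
  let v : Fin r → C := fun i => aeval y (f i)
  have hv : ∀ i, v i ∈ J := fun i => by
    rw [← Ideal.Quotient.eq_zero_iff_mem]
    simp only [v]
    rw [lift_mk y hy, hιI _ (hf i), map_zero]
  let w : Fin r → C := -(M⁻¹.mulVec v)
  have hw : ∀ k, w k ∈ J := fun k => by
    refine J.neg_mem ?_
    simp only [Matrix.mulVec, dotProduct]
    exact J.sum_mem fun i _ => J.mul_mem_left _ (hv i)
  have hMw : ∀ i, ∑ k, M i k * w k = - v i := by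
    have : M.mulVec w = - v := by
      simp only [w, Matrix.mulVec_neg, Matrix.mulVec_mulVec, Matrix.mul_nonsing_inv M hM,
        Matrix.one_mulVec]
    exact fun i => congrFun this i
  let δ : Fin n → C := fun j => ∑ k, if c k = j then w k else 0
  have hδ : ∀ j, δ j ∈ J := fun j => J.sum_mem fun k _ => by
    split_ifs
    exacts [hw k, J.zero_mem]
  have hδsum : ∀ a : Fin n → C, ∑ j, δ j * a j = ∑ k, w k * a (c k) := by
    intro a
    simp only [δ, Finset.sum_mul]
    rw [Finset.sum_comm]
    refine Finset.sum_congr rfl fun k _ => ?_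
    simp [ite_mul]
  let z : Fin n → C := fun i => y i + δ i
  have hz : ∀ i, Ideal.Quotient.mk J (z i) = g (ι (X i)) := fun i => by
    simp only [z]
    rw [map_add, Ideal.Quotient.eq_zero_iff_mem.2 (hδ i), add_zero, hy]
  have hzf : ∀ i, aeval z (f i) = 0 := fun i => by
    rw [taylor_sq_zero y δ (fun i j => hJ0 _ (hδ i) _ (hδ j)), hδsum]
    have h1 := hMw i
    simp only [M, v, Matrix.of_apply] at h1
    simp only [mul_comm (w _)]
    rw [h1, add_neg_cancel]
  have hspan : ∀ p ∈ Ideal.span (Set.range f), aeval z p = 0 := by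
    have : Ideal.span (Set.range f) ≤ RingHom.ker (aeval z : MvPolynomial (Fin n) A →ₐ[A] C) := by
      rw [Ideal.span_le]
      rintro _ ⟨i, rfl⟩
      exact hzf i
    exact fun p hp => this hp
  have hzI : ∀ p ∈ I, aeval z p = 0 := fun p hp => by
    have h1 := hspan _ (Submodule.mem_colon.1 hh p hp)
    rw [smul_eq_mul, map_mul] at h1
    have h2 := hunit z hz
    rw [map_mul] at h2
    exact (isUnit_of_mul_isUnit_left h2).mul_right_eq_zero.1 h1
  let φ : (MvPolynomial (Fin n) A ⧸ I) →ₐ[A] C := Ideal.Quotient.liftₐ I (aeval z) hzI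
  have hφ : ∀ p, φ (Ideal.Quotient.mk I p) = aeval z p := fun p => rfl
  have hφu : IsUnit ((φ : _ →+* C) (Ideal.Quotient.mk I (h * d))) := hunit z hz
  let ψ : L →+* C := IsLocalization.Away.lift (Ideal.Quotient.mk I (h * d)) hφu
  have hψ : ∀ x, ψ (algebraMap _ L x) = φ x := fun x => IsLocalization.Away.lift_eq _ hφu x
  let Ψ : L →ₐ[A] C := { ψ with
    commutes' := fun a => by
      change ψ (algebraMap A L a) = _
      rw [IsScalarTower.algebraMap_apply A (MvPolynomial (Fin n) A ⧸ I) L, hψ, AlgHom.commutes] }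
  refine ⟨Ψ, ?_⟩
  apply AlgHom.coe_ringHom_injective
  refine IsLocalization.ringHom_ext (.powers (Ideal.Quotient.mk I (h * d))) ?_
  refine Ideal.Quotient.ringHom_ext (RingHom.ext fun p => ?_)
  change Ideal.Quotient.mk J (ψ (algebraMap _ L (Ideal.Quotient.mk I p))) = g (ι p)
  rw [hψ, hφ, lift_mk z hz]

theorem stmt_5 (A : Type u) [CommRing A] [IsNoetherianRing A] (n : ℕ)
    (I : Ideal (MvPolynomial (Fin n) A)) (hIfg : I.FG)
    (HBA : Ideal (MvPolynomial (Fin n) A ⧸ I))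
    (hHBA : HBA = (⨆ r : ℕ, ⨆ _ : r ≤ n, ⨆ f : Fin r → MvPolynomial (Fin n) A,
      ⨆ _ : ∀ i, f i ∈ I,
        Ideal.map (Ideal.Quotient.mk I)
          ((Submodule.colon (Ideal.span (Set.range f)) I) *
            Ideal.span { M | ∃ c : Fin r ↪ Fin n,
              M = (Matrix.of fun i k => pderiv (c k) (f i)).det })).radical) :
    (∀ b ∈ HBA, ∀ (L : Type u) [CommRing L] [Algebra (MvPolynomial (Fin n) A ⧸ I) L]
      [Algebra A L] [IsScalarTower A (MvPolynomial (Fin n) A ⧸ I) L]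
      [IsLocalization.Away b L], Algebra.Smooth A L) ∧
    (HBA = ⊤ → Algebra.Smooth A (MvPolynomial (Fin n) A ⧸ I)) := by
  have hfp : Algebra.FinitePresentation A (MvPolynomial (Fin n) A ⧸ I) :=
    Algebra.FinitePresentation.quotient hIfg
  have key : ∀ b ∈ HBA, Algebra.Smooth A (Localization.Away b) := by
    intro b hb
    rw [← Algebra.basicOpen_subset_smoothLocus_iff_smooth]
    intro p hp
    by_contra hps
    refine hp ?_
    have hle : HBA ≤ p.asIdeal := by
      rw [hHBA, p.isPrime.radical_le_iff]
      refine iSup_le fun r => iSup_le fun _ => iSup_le fun f => iSup_le fun hf => ?_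
      rw [Ideal.map_le_iff_le_comap, Ideal.mul_le]
      intro h hh d hd
      suffices Ideal.span { M | ∃ c : Fin r ↪ Fin n,
          M = (Matrix.of fun i k => pderiv (c k) (f i)).det } ≤
          Submodule.colon (p.asIdeal.comap (Ideal.Quotient.mk I)) {h} by
        have := Submodule.mem_colon_singleton.1 (this hd)
        rwa [smul_eq_mul, mul_comm] at this
      rw [Ideal.span_le]
      rintro _ ⟨c, rfl⟩
      rw [SetLike.mem_coe, Submodule.mem_colon_singleton, smul_eq_mul, mul_comm]
      by_contra hn
      apply hps
      have := formallySmooth_elkik I f hf h hh c (Localization.Away (Ideal.Quotient.mk I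
        (h * (Matrix.of fun i k => pderiv (c k) (f i)).det)))
      exact Algebra.basicOpen_subset_smoothLocus_iff.2 this hn
    exact hle hb
  have main : ∀ b ∈ HBA, ∀ (L : Type u) [CommRing L] [Algebra (MvPolynomial (Fin n) A ⧸ I) L]
      [Algebra A L] [IsScalarTower A (MvPolynomial (Fin n) A ⧸ I) L]
      [IsLocalization.Away b L], Algebra.Smooth A L := by
    intro b hb L _ _ _ _ _
    have := key b hb
    exact Algebra.Smooth.of_equiv
      ((IsLocalization.algEquiv (.powers b) (Localization.Away b) L).restrictScalars A)
  refine ⟨main, fun htop => ?_⟩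
  have : IsLocalization.Away (1 : MvPolynomial (Fin n) A ⧸ I) (MvPolynomial (Fin n) A ⧸ I) :=
    IsLocalization.away_of_isUnit_of_bijective _ isUnit_one Function.bijective_id
  exact main 1 (htop ▸ Submodule.mem_top) _
end

section
/- Let B be a commutative ring, b_1,...,b_s ∈ B, and consider E = B[Z, U_1,...,U_s, V, W]/(f, WU_1,...,WU_s) where f_j = g_j − Σ_i U_i V_{ij} for given g_j ∈ B[Z]. Then for each i, the localization E_{U_i} is isomorphic to a polynomial ring over B[U_i, U_i^{-1}], and hence is a smooth B-algebra. -/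
open MvPolynomial

universe u

/-- Index set of the free variables remaining in `E_{U_i}`. -/
abbrev FreeIdx (s e : ℕ) (i : Fin s) : Type :=
  Fin s ⊕ ({k : Fin s // k ≠ i} ⊕ ({k : Fin s // k ≠ i} × Fin e))

lemma laurent_smooth (B : Type u) [CommRing B] : Algebra.Smooth B (LaurentPolynomial B) := by
  have : Algebra.Smooth (Polynomial B) (LaurentPolynomial B) :=
    Algebra.Smooth.of_isLocalization_Away (Polynomial.X : Polynomial B)
  have : Algebra.Smooth B (Polynomial B) := {}
  have : IsScalarTower B (Polynomial B) (LaurentPolynomial B) := by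
    refine IsScalarTower.of_algebraMap_eq fun x => ?_
    simp [LaurentPolynomial.algebraMap_eq_toLaurent, ← LaurentPolynomial.C_eq_algebraMap]
  exact Algebra.Smooth.comp B (Polynomial B) (LaurentPolynomial B)

lemma mv_laurent_smooth (B : Type u) [CommRing B] (m : ℕ) :
    Algebra.Smooth B (MvPolynomial (Fin m) (LaurentPolynomial B)) := by
  have := laurent_smooth B
  have : Algebra.Smooth (LaurentPolynomial B) (MvPolynomial (Fin m) (LaurentPolynomial B)) := {}
  exact Algebra.Smooth.comp B (LaurentPolynomial B) _

lemma laurent_hom_ext {B A : Type*} [CommRing B] [CommRing A]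
    {f g : LaurentPolynomial B →+* A} (hC : ∀ b, f (LaurentPolynomial.C b) = g (LaurentPolynomial.C b))
    (hT : f (LaurentPolynomial.T 1) = g (LaurentPolynomial.T 1)) : f = g := by
  refine IsLocalization.ringHom_ext (Submonoid.powers (Polynomial.X : Polynomial B)) ?_
  refine Polynomial.ringHom_ext (fun a => ?_) ?_
  · simpa [LaurentPolynomial.algebraMap_eq_toLaurent] using hC a
  · simpa [LaurentPolynomial.algebraMap_eq_toLaurent] using hT

section maps
variable {B : Type u} [CommRing B] {s e : ℕ} (g : Fin e → MvPolynomial (Fin s) B) (i : Fin s)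

/-- images of `Z` -/
noncomputable def zP (a : Fin s) : MvPolynomial (FreeIdx s e i) (LaurentPolynomial B) :=
  X (Sum.inl a)

/-- images of `U` -/
noncomputable def uP (k : Fin s) : MvPolynomial (FreeIdx s e i) (LaurentPolynomial B) :=
  if h : k = i then C (LaurentPolynomial.T 1) else X (Sum.inr (Sum.inl ⟨k, h⟩))

/-- images of `V` -/
noncomputable def vP (k : Fin s) (j : Fin e) :
    MvPolynomial (FreeIdx s e i) (LaurentPolynomial B) :=
  if h : k = i then C (LaurentPolynomial.T (-1)) * (aeval (zP (B := B) (e := e) i) (g j) -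
      ∑ k : {k : Fin s // k ≠ i}, X (Sum.inr (Sum.inl k)) * X (Sum.inr (Sum.inr (k, j))))
  else X (Sum.inr (Sum.inr (⟨k, h⟩, j)))

/-- the map from `B[Z,U,V,W]` -/
noncomputable def phi0 : MvPolynomial ((Fin s) ⊕ (Fin s) ⊕ ((Fin s × Fin e) ⊕ Unit)) B →ₐ[B]
    MvPolynomial (FreeIdx s e i) (LaurentPolynomial B) :=
  aeval (Sum.elim (zP i) (Sum.elim (uP i) (Sum.elim (fun p => vP g i p.1 p.2) (fun _ => 0))))

lemma uP_self : uP (B := B) (e := e) i i = C (LaurentPolynomial.T 1) := by simp [uP]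

lemma uP_unit : IsUnit (uP (B := B) (e := e) i i) := by
  rw [uP_self]; exact (LaurentPolynomial.isUnit_T 1).map C

lemma sum_uv (j : Fin e) : ∑ k, uP i k * vP g i k j = aeval (zP (B := B) (e := e) i) (g j) := by
  rw [Fintype.sum_eq_add_sum_subtype_ne _ i]
  have h1 : ∀ k : {k : Fin s // k ≠ i}, uP i k.1 * vP g i k.1 j =
      X (Sum.inr (Sum.inl k)) * X (Sum.inr (Sum.inr (k, j))) := by
    intro k; simp [uP, vP, k.2]
  rw [Finset.sum_congr rfl fun k _ => h1 k, uP_self]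
  have h2 : vP g i i j = C (LaurentPolynomial.T (-1)) * (aeval (zP (B := B) (e := e) i) (g j) -
      ∑ k : {k : Fin s // k ≠ i}, X (Sum.inr (Sum.inl k)) * X (Sum.inr (Sum.inr (k, j)))) := by
    simp [vP]
  rw [h2, ← mul_assoc, ← C_mul, ← LaurentPolynomial.T_add]
  simp

variable {L : Type u} [CommRing L] [Algebra B L]
  (p : MvPolynomial ((Fin s) ⊕ (Fin s) ⊕ ((Fin s × Fin e) ⊕ Unit)) B →ₐ[B] L)
  (t : Lˣ)

/-- the map back -/
noncomputable def psi : MvPolynomial (FreeIdx s e i) (LaurentPolynomial B) →ₐ[B] L :=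
  { eval₂Hom (LaurentPolynomial.eval₂ (algebraMap B L) t)
      (Sum.elim (fun a => p (X (Sum.inl a))) (Sum.elim (fun k => p (X (Sum.inr (Sum.inl k.1))))
        (fun q => p (X (Sum.inr (Sum.inr (Sum.inl (q.1.1, q.2)))))))) with
    commutes' := fun b => by
      have : algebraMap B (MvPolynomial (FreeIdx s e i) (LaurentPolynomial B)) b
        = C (LaurentPolynomial.C b) := by
          rw [MvPolynomial.algebraMap_apply, LaurentPolynomial.C_eq_algebraMap]
      rw [this]
      simp }

lemma psi_X (x) : psi i p t (X x) =
    (Sum.elim (fun a => p (X (Sum.inl a))) (Sum.elim (fun k => p (X (Sum.inr (Sum.inl k.1))))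
        (fun q => p (X (Sum.inr (Sum.inr (Sum.inl (q.1.1, q.2)))))))) x :=
  eval₂Hom_X' _ _ _

lemma psi_C (x) : psi i p t (C x) = LaurentPolynomial.eval₂ (algebraMap B L) t x :=
  eval₂Hom_C _ _ _

lemma psi_phi0 (ht : p (X (Sum.inr (Sum.inl i))) = t)
    (hf : ∀ j, p (rename Sum.inl (g j)) =
      ∑ k, p (X (Sum.inr (Sum.inl k))) * p (X (Sum.inr (Sum.inr (Sum.inl (k, j))))))
    (hW : p (X (Sum.inr (Sum.inr (Sum.inr ())))) * t = 0) :
    (psi i p t).comp (phi0 g i) = p := by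
  have hz : ∀ q : MvPolynomial (Fin s) B,
      psi i p t (aeval (zP (B := B) (e := e) i) q) = p (rename Sum.inl q) := by
    intro q
    have : (psi i p t).comp (aeval (zP (B := B) (e := e) i)) = p.comp (rename Sum.inl) := by
      ext a
      simp [zP, psi_X]
    exact DFunLike.congr_fun this q
  refine MvPolynomial.algHom_ext fun x => ?_
  rcases x with a | k | ⟨k, j⟩ | ⟨⟩
  · simp [phi0, zP, psi_X]
  · by_cases h : k = i
    · subst h
      simp [phi0, uP, psi_C, ht]
    · simp [phi0, uP, psi_X, h]
  · by_cases h : k = i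
    · subst h
      have := hf j
      rw [Fintype.sum_eq_add_sum_subtype_ne _ k, ht] at this
      simp [phi0, vP, psi_C, psi_X, hz, this]
    · simp [phi0, vP, psi_X, h]
  · have : p (X (Sum.inr (Sum.inr (Sum.inr ())))) = 0 := by
      simpa using hW
    simp [phi0, this]

end maps

/-- Let `E = B[Z,U,V,W]/(f, WU_1,...,WU_s)` with `f_j = g_j − Σ_i U_i V_{ij}`.
Then for each `i` the localization `E_{U_i}` is isomorphic to a polynomial ring
over `B[U_i, U_i⁻¹]`, hence is a smooth `B`-algebra. -/
theorem stmt_6 (B : Type u) [CommRing B] [IsNoetherianRing B] (s e : ℕ)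
    (g : Fin e → MvPolynomial (Fin s) B)
    -- the ambient polynomial ring `B[Z, U, V, W]`
    (W : MvPolynomial ((Fin s) ⊕ (Fin s) ⊕ ((Fin s × Fin e) ⊕ Unit)) B)
    (hW : W = X (Sum.inr (Sum.inr (Sum.inr ()))))
    (U : Fin s → MvPolynomial ((Fin s) ⊕ (Fin s) ⊕ ((Fin s × Fin e) ⊕ Unit)) B)
    (hU : ∀ i, U i = X (Sum.inr (Sum.inl i)))
    (V : Fin s → Fin e → MvPolynomial ((Fin s) ⊕ (Fin s) ⊕ ((Fin s × Fin e) ⊕ Unit)) B)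
    (hV : ∀ i j, V i j = X (Sum.inr (Sum.inr (Sum.inl (i, j)))))
    (f : Fin e → MvPolynomial ((Fin s) ⊕ (Fin s) ⊕ ((Fin s × Fin e) ⊕ Unit)) B)
    (hf : ∀ j, f j = rename Sum.inl (g j) - ∑ i, U i * V i j)
    (J : Ideal (MvPolynomial ((Fin s) ⊕ (Fin s) ⊕ ((Fin s × Fin e) ⊕ Unit)) B))
    (hJ : J = Ideal.span (Set.range f ∪ Set.range fun i => W * U i)) :
    ∀ i : Fin s, ∀ (L : Type u) [CommRing L]
      [Algebra (MvPolynomial ((Fin s) ⊕ (Fin s) ⊕ ((Fin s × Fin e) ⊕ Unit)) B ⧸ J) L]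
      [IsLocalization.Away (Ideal.Quotient.mk J (U i)) L]
      [Algebra B L]
      [IsScalarTower B (MvPolynomial ((Fin s) ⊕ (Fin s) ⊕ ((Fin s × Fin e) ⊕ Unit)) B ⧸ J) L],
      (∃ m : ℕ, Nonempty (L ≃ₐ[B] MvPolynomial (Fin m) (LaurentPolynomial B))) ∧
        Algebra.Smooth B L := by
  intro i L _ _ _ _ _
  obtain rfl : U = fun i => X (Sum.inr (Sum.inl i)) := funext hU
  obtain rfl : V = fun i j => X (Sum.inr (Sum.inr (Sum.inl (i, j)))) :=
    funext fun i => funext fun j => hV i j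
  suffices H : Nonempty (L ≃ₐ[B] MvPolynomial (FreeIdx s e i) (LaurentPolynomial B)) by
    obtain ⟨E⟩ := H
    let E' := E.trans ((renameEquiv (LaurentPolynomial B)
      (Fintype.equivFin (FreeIdx s e i))).restrictScalars B)
    have := mv_laurent_smooth B (Fintype.card (FreeIdx s e i))
    exact ⟨⟨_, ⟨E'⟩⟩, Algebra.Smooth.of_equiv E'.symm⟩
  let p : MvPolynomial ((Fin s) ⊕ (Fin s) ⊕ ((Fin s × Fin e) ⊕ Unit)) B →ₐ[B] L :=
    (IsScalarTower.toAlgHom B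
      (MvPolynomial ((Fin s) ⊕ (Fin s) ⊕ ((Fin s × Fin e) ⊕ Unit)) B ⧸ J) L).comp
      (Ideal.Quotient.mkₐ B J)
  have hp : ∀ x, p x = algebraMap _ L (Ideal.Quotient.mk J x) := fun x => rfl
  have hp0 : ∀ x ∈ J, p x = 0 := fun x hx => by
    rw [hp, Ideal.Quotient.eq_zero_iff_mem.mpr hx, map_zero]
  have hfJ : ∀ j, f j ∈ J := fun j => by
    rw [hJ]; exact Ideal.subset_span (Or.inl ⟨j, rfl⟩)
  have hWJ : ∀ k, W * X (Sum.inr (Sum.inl k)) ∈ J := fun k => by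
    rw [hJ]; exact Ideal.subset_span (Or.inr ⟨k, rfl⟩)
  have hu : IsUnit (p (X (Sum.inr (Sum.inl i)))) :=
    IsLocalization.Away.algebraMap_isUnit (S := L)
      (Ideal.Quotient.mk J (X (Sum.inr (Sum.inl i))))
  obtain ⟨t, ht⟩ := hu
  have hpsi := psi_phi0 g i p t ht.symm
    (fun j => by
      have := hp0 _ (hfJ j)
      rw [hf, map_sub, sub_eq_zero] at this
      simpa using this)
    (by
      have := hp0 _ (hWJ i)
      rwa [map_mul, ← ht, hW] at this)
  have hker : ∀ x ∈ J, phi0 g i x = 0 := by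
    intro x hx
    have : J ≤ RingHom.ker (phi0 g i) := by
      rw [hJ, Ideal.span_le]
      rintro _ (⟨j, rfl⟩ | ⟨k, rfl⟩)
      · simp only [SetLike.mem_coe, RingHom.mem_ker, hf, map_sub, map_sum, map_mul]
        rw [sub_eq_zero]
        have h1 := sum_uv g i j
        simp only [phi0, aeval_X, aeval_rename, Sum.elim_inr, Sum.elim_inl]
        rw [h1]
        rfl
      · simp [phi0, hW]
    exact this hx
  let q := Ideal.Quotient.liftₐ J (phi0 g i) hker
  have hq : IsUnit (q (Ideal.Quotient.mk J (X (Sum.inr (Sum.inl i))))) := by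
    have : q (Ideal.Quotient.mk J (X (Sum.inr (Sum.inl i)))) = uP i i := by
      change phi0 g i _ = _
      simp [phi0]
    rw [this]; exact uP_unit i
  let phi : L →ₐ[B] MvPolynomial (FreeIdx s e i) (LaurentPolynomial B) :=
    IsLocalization.Away.liftAlgHom (Ideal.Quotient.mk J (X (Sum.inr (Sum.inl i)))) (f := q) hq
  have hphi : ∀ x, phi (p x) = phi0 g i x := fun x =>
    IsLocalization.Away.lift_eq (Ideal.Quotient.mk J (X (Sum.inr (Sum.inl i)))) hq _
  refine ⟨AlgEquiv.ofAlgHom phi (psi i p t) ?_ ?_⟩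
  · apply AlgHom.coe_ringHom_injective
    refine MvPolynomial.ringHom_ext' ?_ fun x => ?_
    · refine laurent_hom_ext (fun b => ?_) ?_
      · change phi (psi i p t (C (LaurentPolynomial.C b))) = C (LaurentPolynomial.C b)
        rw [psi_C, LaurentPolynomial.eval₂_C, AlgHom.commutes, MvPolynomial.algebraMap_apply,
          LaurentPolynomial.C_eq_algebraMap]
      · simp [psi_C, ht, hphi, phi0, uP_self]
    · rcases x with a | k | ⟨k, j⟩
      · simp [psi_X, hphi, phi0, zP]
      · simp [psi_X, hphi, phi0, uP, k.2]
      · simp [psi_X, hphi, phi0, vP, k.2]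
  · refine IsLocalization.algHom_ext
      (Submonoid.powers (Ideal.Quotient.mk J (X (Sum.inr (Sum.inl i))))) ?_
    refine Ideal.Quotient.algHom_ext _ ?_
    refine AlgHom.ext fun x => ?_
    change psi i p t (phi (p x)) = p x
    rw [hphi]
    exact DFunLike.congr_fun hpsi x
end

section
/- With E = B[Z,U,V,W]/(f, WU_1,...,WU_s) as above where f_j = g_j − Σ_i U_i V_{ij}, the localization E_W is isomorphic as a B-algebra to C[V, W, W^{-1}] where C = B[Z]/(g). -/
open MvPolynomial

universe u

theorem laurent_hom_ext_s7 {R S : Type*} [CommSemiring R] [Semiring S]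
    {a b : LaurentPolynomial R →+* S}
    (hC : ∀ r, a (LaurentPolynomial.C r) = b (LaurentPolynomial.C r))
    (hT : a (LaurentPolynomial.T 1) = b (LaurentPolynomial.T 1)) : a = b := by
  apply IsLocalization.ringHom_ext (Submonoid.powers (Polynomial.X : Polynomial R))
  apply Polynomial.ringHom_ext
  · intro r
    simpa [LaurentPolynomial.algebraMap_eq_toLaurent] using hC r
  · simpa [LaurentPolynomial.algebraMap_eq_toLaurent] using hT

set_option maxHeartbeats 2000000 in
/-- With `E = B[Z,U,V,W]/(f, WU_1,...,WU_s)`, `f_j = g_j − Σ_i U_i V_{ij}`, the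
localization `E_W` is isomorphic as a `B`-algebra to `C[V, W, W⁻¹]` where
`C = B[Z]/(g)`. -/
theorem stmt_7 (B : Type u) [CommRing B] (s e : ℕ)
    (g : Fin e → MvPolynomial (Fin s) B)
    (W : MvPolynomial ((Fin s) ⊕ (Fin s) ⊕ ((Fin s × Fin e) ⊕ Unit)) B)
    (hW : W = X (Sum.inr (Sum.inr (Sum.inr ()))))
    (U : Fin s → MvPolynomial ((Fin s) ⊕ (Fin s) ⊕ ((Fin s × Fin e) ⊕ Unit)) B)
    (hU : ∀ i, U i = X (Sum.inr (Sum.inl i)))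
    (V : Fin s → Fin e → MvPolynomial ((Fin s) ⊕ (Fin s) ⊕ ((Fin s × Fin e) ⊕ Unit)) B)
    (hV : ∀ i j, V i j = X (Sum.inr (Sum.inr (Sum.inl (i, j)))))
    (f : Fin e → MvPolynomial ((Fin s) ⊕ (Fin s) ⊕ ((Fin s × Fin e) ⊕ Unit)) B)
    (hf : ∀ j, f j = rename Sum.inl (g j) - ∑ i, U i * V i j)
    (J : Ideal (MvPolynomial ((Fin s) ⊕ (Fin s) ⊕ ((Fin s × Fin e) ⊕ Unit)) B))
    (hJ : J = Ideal.span (Set.range f ∪ Set.range fun i => W * U i)) :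
    ∀ (L : Type u) [CommRing L]
      [Algebra (MvPolynomial ((Fin s) ⊕ (Fin s) ⊕ ((Fin s × Fin e) ⊕ Unit)) B ⧸ J) L]
      [IsLocalization.Away (Ideal.Quotient.mk J W) L]
      [Algebra B L]
      [IsScalarTower B (MvPolynomial ((Fin s) ⊕ (Fin s) ⊕ ((Fin s × Fin e) ⊕ Unit)) B ⧸ J) L],
      Nonempty (L ≃ₐ[B] LaurentPolynomial (MvPolynomial (Fin s × Fin e)
        (MvPolynomial (Fin s) B ⧸ Ideal.span (Set.range g)))) := by
  intro L _ _ _ _ _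
  classical
  -- forward map
  let ι : (MvPolynomial (Fin s) B ⧸ Ideal.span (Set.range g)) →ₐ[B] (LaurentPolynomial (MvPolynomial (Fin s × Fin e) (MvPolynomial (Fin s) B ⧸ Ideal.span (Set.range g)))) := IsScalarTower.toAlgHom B (MvPolynomial (Fin s) B ⧸ Ideal.span (Set.range g)) (LaurentPolynomial (MvPolynomial (Fin s × Fin e) (MvPolynomial (Fin s) B ⧸ Ideal.span (Set.range g))))
  let q : MvPolynomial (Fin s) B →ₐ[B] (MvPolynomial (Fin s) B ⧸ Ideal.span (Set.range g)) := Ideal.Quotient.mkₐ B _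
  let φ : MvPolynomial ((Fin s) ⊕ (Fin s) ⊕ ((Fin s × Fin e) ⊕ Unit)) B →ₐ[B] (LaurentPolynomial (MvPolynomial (Fin s × Fin e) (MvPolynomial (Fin s) B ⧸ Ideal.span (Set.range g)))) := aeval (Sum.elim (fun i => ι (q (X i)))
    (Sum.elim (fun _ => 0) (Sum.elim (fun p => LaurentPolynomial.C (X p))
      (fun _ => LaurentPolynomial.T 1))))
  have φZ : ∀ p : MvPolynomial (Fin s) B, φ (rename Sum.inl p) = ι (q p) := by
    intro p
    have : φ.comp (rename Sum.inl) = ι.comp q := by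
      apply MvPolynomial.algHom_ext
      intro i
      simp [φ]
    exact DFunLike.congr_fun this p
  have φU : ∀ i, φ (U i) = 0 := by intro i; simp [φ, hU]
  have φV : ∀ i j, φ (V i j) = LaurentPolynomial.C (X (i, j)) := by
    intro i j; simp [φ, hV]
  have φW : φ W = LaurentPolynomial.T 1 := by simp [φ, hW]
  have φJ : ∀ a ∈ J, φ a = 0 := by
    intro a ha
    have : J ≤ RingHom.ker φ := by
      rw [hJ, Ideal.span_le]
      rintro _ (⟨j, rfl⟩ | ⟨i, rfl⟩)
      · have hq : q (g j) = 0 :=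
          Ideal.Quotient.eq_zero_iff_mem.mpr (Ideal.subset_span ⟨j, rfl⟩)
        simp only [SetLike.mem_coe, RingHom.mem_ker]
        have h : f j + ∑ i, U i * V i j = rename Sum.inl (g j) := by rw [hf]; ring
        have h2 := congrArg φ h
        rw [map_add, φZ, hq, map_sum, map_zero] at h2
        simpa only [map_mul, φU, zero_mul, Finset.sum_const_zero, add_zero] using h2
      · simp only [SetLike.mem_coe, RingHom.mem_ker]
        rw [map_mul, φU, mul_zero]
    exact this ha
  let φ₁ : (MvPolynomial ((Fin s) ⊕ (Fin s) ⊕ ((Fin s × Fin e) ⊕ Unit)) B ⧸ J) →ₐ[B] (LaurentPolynomial (MvPolynomial (Fin s × Fin e) (MvPolynomial (Fin s) B ⧸ Ideal.span (Set.range g)))) := Ideal.Quotient.liftₐ J φ φJ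
  have φ₁mk : ∀ p, φ₁ (Ideal.Quotient.mk J p) = φ p := fun p => rfl
  have hu : IsUnit (φ₁ (Ideal.Quotient.mk J W)) := by
    rw [φ₁mk, φW]; exact LaurentPolynomial.isUnit_T 1
  let F : L →ₐ[B] (LaurentPolynomial (MvPolynomial (Fin s × Fin e) (MvPolynomial (Fin s) B ⧸ Ideal.span (Set.range g)))) := IsLocalization.Away.liftAlgHom (Ideal.Quotient.mk J W) hu
  -- backward map
  let π : MvPolynomial ((Fin s) ⊕ (Fin s) ⊕ ((Fin s × Fin e) ⊕ Unit)) B →ₐ[B] L :=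
    (IsScalarTower.toAlgHom B (MvPolynomial ((Fin s) ⊕ (Fin s) ⊕ ((Fin s × Fin e) ⊕ Unit)) B ⧸ J) L).comp (Ideal.Quotient.mkₐ B J)
  have Fπ : ∀ p, F (π p) = φ p := fun p =>
    IsLocalization.Away.lift_eq (Ideal.Quotient.mk J W) hu _
  have πJ : ∀ a ∈ J, π a = 0 := by
    intro a ha
    have : Ideal.Quotient.mk J a = 0 := Ideal.Quotient.eq_zero_iff_mem.mpr ha
    change algebraMap _ L (Ideal.Quotient.mk J a) = 0
    rw [this, map_zero]
  have πW : IsUnit (π W) := IsLocalization.Away.algebraMap_isUnit (Ideal.Quotient.mk J W)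
  have πU : ∀ i, π (U i) = 0 := by
    intro i
    have h : π (W * U i) = 0 := πJ _ (by
      rw [hJ]; exact Ideal.subset_span (Or.inr ⟨i, rfl⟩))
    rw [map_mul] at h
    exact (πW.mul_right_eq_zero).mp h
  have πg : ∀ j, π (rename Sum.inl (g j)) = 0 := by
    intro j
    have h : π (f j) = 0 := πJ _ (by
      rw [hJ]; exact Ideal.subset_span (Or.inl ⟨j, rfl⟩))
    rw [hf, map_sub, map_sum] at h
    simpa [πU] using h
  let ψ₀ : (MvPolynomial (Fin s) B ⧸ Ideal.span (Set.range g)) →ₐ[B] L := Ideal.Quotient.liftₐ _ (π.comp (rename Sum.inl)) (by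
    intro a ha
    have : Ideal.span (Set.range g) ≤ RingHom.ker (π.comp (rename Sum.inl)) := by
      rw [Ideal.span_le]
      rintro _ ⟨j, rfl⟩
      exact πg j
    exact this ha)
  have ψ₀q : ∀ p, ψ₀ (q p) = π (rename Sum.inl p) := fun p => rfl
  let ψ₁ : MvPolynomial (Fin s × Fin e) (MvPolynomial (Fin s) B ⧸ Ideal.span (Set.range g)) →+* L :=
    eval₂Hom (ψ₀ : (MvPolynomial (Fin s) B ⧸ Ideal.span (Set.range g)) →+* L) (fun p => π (V p.1 p.2))
  let G : (LaurentPolynomial (MvPolynomial (Fin s × Fin e) (MvPolynomial (Fin s) B ⧸ Ideal.span (Set.range g)))) →+* L := LaurentPolynomial.eval₂ ψ₁ πW.unit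
  have GC : ∀ r, G (LaurentPolynomial.C r) = ψ₁ r := fun r => LaurentPolynomial.eval₂_C _ _ r
  have GT : G (LaurentPolynomial.T 1) = π W := by
    have := LaurentPolynomial.eval₂_T ψ₁ πW.unit 1
    rw [zpow_one] at this
    exact this
  have Gι : ∀ c, G (ι c) = ψ₀ c := by
    intro c
    have : ι c = LaurentPolynomial.C (MvPolynomial.C c) := rfl
    rw [this, GC]
    simp [ψ₁]
  have GB : ∀ b, G (algebraMap B (LaurentPolynomial (MvPolynomial (Fin s × Fin e) (MvPolynomial (Fin s) B ⧸ Ideal.span (Set.range g)))) b) = algebraMap B L b := by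
    intro b
    rw [← ι.commutes, Gι, ψ₀.commutes]
  let G' : (LaurentPolynomial (MvPolynomial (Fin s × Fin e) (MvPolynomial (Fin s) B ⧸ Ideal.span (Set.range g)))) →ₐ[B] L := { G with commutes' := GB }
  have hG' : ∀ x, G' x = G x := fun _ => rfl
  have GF : ∀ x, G (F x) = x := by
    have h1 : G'.comp φ = π := by
      apply MvPolynomial.algHom_ext
      rintro (i | i | ⟨i, j⟩ | ⟨⟩)
      · have := φZ (X i)
        rw [rename_X] at this
        rw [AlgHom.comp_apply, this, hG', Gι, ψ₀q, rename_X]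
      · rw [← hU, AlgHom.comp_apply, φU, πU, map_zero]
      · rw [← hV, AlgHom.comp_apply, φV, hG', GC]
        simp [ψ₁]
      · rw [← hW, AlgHom.comp_apply, φW, hG', GT]
    have h2 : G.comp (F : L →+* (LaurentPolynomial (MvPolynomial (Fin s × Fin e) (MvPolynomial (Fin s) B ⧸ Ideal.span (Set.range g))))) = RingHom.id L := by
      apply IsLocalization.ringHom_ext (Submonoid.powers (Ideal.Quotient.mk J W))
      apply Ideal.Quotient.ringHom_ext
      apply MvPolynomial.ringHom_ext
      · intro b
        exact (congrArg G (Fπ _)).trans (DFunLike.congr_fun h1 (C b))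
      · intro p
        exact (congrArg G (Fπ _)).trans (DFunLike.congr_fun h1 (X p))
    exact fun x => DFunLike.congr_fun h2 x
  have FG : ∀ x, F (G x) = x := by
    have hq : ∀ c, F (ψ₀ c) = ι c := by
      intro c
      obtain ⟨p, rfl⟩ := Ideal.Quotient.mk_surjective c
      exact (Fπ _).trans (φZ p)
    have hC : ∀ r, F (ψ₁ r) = LaurentPolynomial.C r := by
      have : (F : L →+* (LaurentPolynomial (MvPolynomial (Fin s × Fin e) (MvPolynomial (Fin s) B ⧸ Ideal.span (Set.range g))))).comp ψ₁ = LaurentPolynomial.C := by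
        apply MvPolynomial.ringHom_ext
        · intro c
          have : ψ₁ (MvPolynomial.C c) = ψ₀ c := by simp [ψ₁]
          rw [RingHom.comp_apply, this]
          exact hq c
        · rintro ⟨i, j⟩
          have : ψ₁ (X (i, j)) = π (V i j) := by simp [ψ₁]
          rw [RingHom.comp_apply, this]
          exact (Fπ _).trans (φV i j)
      exact fun r => DFunLike.congr_fun this r
    have h : (F : L →+* (LaurentPolynomial (MvPolynomial (Fin s × Fin e) (MvPolynomial (Fin s) B ⧸ Ideal.span (Set.range g))))).comp G = RingHom.id (LaurentPolynomial (MvPolynomial (Fin s × Fin e) (MvPolynomial (Fin s) B ⧸ Ideal.span (Set.range g)))) := by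
      apply laurent_hom_ext_s7
      · intro r
        rw [RingHom.comp_apply, GC]
        exact hC r
      · rw [RingHom.comp_apply, GT]
        exact (Fπ _).trans φW
    exact fun x => DFunLike.congr_fun h x
  exact ⟨AlgEquiv.ofAlgHom F G' (AlgHom.ext FG) (AlgHom.ext GF)⟩
end
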